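/- arXiv:1405.2423 — 5 statements merged into one kernel-verified Lean document; each statement's English description precedes it below -/
import Mathlib

section
/- Let R > 0 and let Λ ⊂ ℝ² be a unimodular lattice such that every nonzero λ = (λ₁, λ₂) ∈ Λ with λ₂ = 0 satisfies |λ₁| > 2R (i.e. the horizontal slits of length 2R centered at the lattice points are pairwise disjoint). Then there exists a positive basis (γ⁺, γ⁻) of Λ such that the closed segment [-R, R] × {0} is contained in the interior of the centered parallelogram P(γ⁺, γ⁻). -/
/-- The set ℝ₊₊ = {(x, y) : x > 0, y ≥ 0}. -/
def Rpp : Set (ℝ × ℝ) := {p | 0 < p.1 ∧ 0 ≤ p.2}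

/-- The set ℝ₋₊ = {(x, y) : x ≤ 0, y > 0}. -/
def Rmp : Set (ℝ × ℝ) := {p | p.1 ≤ 0 ∧ 0 < p.2}

/-- The lattice ℤa + ℤb spanned by two vectors. -/
def latticeOf (a b : ℝ × ℝ) : Set (ℝ × ℝ) :=
  {v | ∃ m n : ℤ, v = (m : ℝ) • a + (n : ℝ) • b}

/-- The interior of the centered parallelogram P(a, b),
i.e. the open parallelogram {s·a + s'·b : s, s' ∈ (-1/2, 1/2)}. -/
def interiorP (a b : ℝ × ℝ) : Set (ℝ × ℝ) :=
  {v | ∃ s s' : ℝ, s ∈ Set.Ioo (-(1/2) : ℝ) (1/2) ∧ s' ∈ Set.Ioo (-(1/2) : ℝ) (1/2) ∧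
    v = s • a + s' • b}

/-- `(a, b)` is a positively oriented basis, of covolume one, of the lattice `L`. -/
def IsOrientedBasis (L : Set (ℝ × ℝ)) (a b : ℝ × ℝ) : Prop :=
  L = latticeOf a b ∧ a.1 * b.2 - a.2 * b.1 = 1

theorem latticeOf_comm (a b : ℝ × ℝ) : latticeOf a b = latticeOf b a := by
  ext v
  constructor <;> rintro ⟨m, n, rfl⟩ <;> exact ⟨n, m, add_comm _ _⟩

theorem latticeOf_neg_left (a b : ℝ × ℝ) : latticeOf (-a) b = latticeOf a b := by
  ext v
  constructor <;> rintro ⟨m, n, rfl⟩ <;> refine ⟨-m, n, ?_⟩ <;> push_cast <;> module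

theorem latticeOf_sub_zsmul_right (a b : ℝ × ℝ) (k : ℤ) :
    latticeOf a (b - (k : ℝ) • a) = latticeOf a b := by
  ext v
  constructor
  · rintro ⟨m, n, rfl⟩
    refine ⟨m - n * k, n, ?_⟩
    push_cast
    module
  · rintro ⟨m, n, rfl⟩
    refine ⟨m + n * k, n, ?_⟩
    push_cast
    module

namespace IsOrientedBasis

variable {L : Set (ℝ × ℝ)} {a b : ℝ × ℝ}

theorem sub_right (h : IsOrientedBasis L a b) (k : ℤ) :
    IsOrientedBasis L a (b - (k : ℝ) • a) := by
  refine ⟨by rw [latticeOf_sub_zsmul_right, h.1], ?_⟩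
  have := h.2
  simp only [Prod.fst_sub, Prod.snd_sub, Prod.smul_fst, Prod.smul_snd, smul_eq_mul]
  linarith

theorem sub_left (h : IsOrientedBasis L a b) (k : ℤ) :
    IsOrientedBasis L (a - (k : ℝ) • b) b := by
  refine ⟨by rw [latticeOf_comm, latticeOf_sub_zsmul_right, latticeOf_comm, h.1], ?_⟩
  have := h.2
  simp only [Prod.fst_sub, Prod.snd_sub, Prod.smul_fst, Prod.smul_snd, smul_eq_mul]
  linarith

theorem left_mem (h : IsOrientedBasis L a b) : a ∈ L := by
  rw [h.1]
  exact ⟨1, 0, by simp⟩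

/-- Subtractive Euclidean algorithm: a basis in the right upper quadrant can be transformed
into a positive basis. -/
theorem exists_positive_of_quadrant {A : ℝ} (hA : 0 < A) (n : ℕ) :
    ∀ a b : ℝ × ℝ, IsOrientedBasis L a b → a ∈ Rpp → b ∈ Rpp → a.1 ≤ A → b.2 ≤ A →
      b.1 + a.2 ≤ n * (1 / A) → ∃ c ∈ Rpp, ∃ d ∈ Rmp, IsOrientedBasis L c d := by
  induction n with
  | zero =>
    rintro a b - ⟨-, ha⟩ ⟨hb, -⟩ - - h
    simp only [Nat.cast_zero, zero_mul] at h
    linarith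
  | succ n ih =>
    rintro a b h ⟨ha1, ha2⟩ ⟨hb1, hb2⟩ haA hbA hn
    have hdet := h.2
    push_cast at hn
    have hab : 1 ≤ a.1 * b.2 := by nlinarith [mul_nonneg ha2 hb1.le]
    have ha : 1 / A ≤ a.1 := by
      rw [div_le_iff₀ hA]
      nlinarith [mul_le_mul_of_nonneg_left hbA ha1.le]
    have hb : 1 / A ≤ b.2 := by
      rw [div_le_iff₀ hA]
      nlinarith [mul_le_mul_of_nonneg_right haA hb2]
    have hr := h.sub_right 1
    have hl := h.sub_left 1
    simp only [Int.cast_one, one_smul] at hr hl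
    rcases lt_or_ge a.2 b.2 with h2 | h2
    · rcases lt_or_ge a.1 b.1 with h1 | h1
      · refine ih _ _ hr ⟨ha1, ha2⟩ ⟨?_, ?_⟩ haA ?_ ?_ <;>
          simp only [Prod.fst_sub, Prod.snd_sub] <;> linarith
      · refine ⟨a, ⟨ha1, ha2⟩, b - a, ⟨?_, ?_⟩, hr⟩ <;>
          simp only [Prod.fst_sub, Prod.snd_sub] <;> linarith
    · have h1 : b.1 < a.1 := by
        by_contra! h1
        nlinarith [mul_le_mul h1 h2 hb2 hb1.le]
      refine ih _ _ hl ⟨?_, ?_⟩ ⟨hb1, hb2⟩ ?_ hbA ?_ <;>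
        simp only [Prod.fst_sub, Prod.snd_sub] <;> linarith

theorem exists_positive_of_mem_Rpp (h : IsOrientedBasis L a b) (ha : a ∈ Rpp) (hb : b ∈ Rpp) :
    ∃ c ∈ Rpp, ∃ d ∈ Rmp, IsOrientedBasis L c d := by
  have hA : 0 < max a.1 b.2 := lt_max_of_lt_left ha.1
  obtain ⟨n, hn⟩ := exists_nat_ge ((b.1 + a.2) / (1 / max a.1 b.2))
  rw [div_le_iff₀ (by positivity)] at hn
  exact exists_positive_of_quadrant hA n a b h ha hb (le_max_left _ _) (le_max_right _ _) hn

theorem exists_positive_of_mem_Rmp (h : IsOrientedBasis L a b) (ha : a ∈ Rmp) (hb : b ∈ Rmp) :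
    ∃ c ∈ Rpp, ∃ d ∈ Rmp, IsOrientedBasis L c d := by
  have hrot : IsOrientedBasis (latticeOf (a.2, -a.1) (b.2, -b.1)) (a.2, -a.1) (b.2, -b.1) :=
    ⟨rfl, by have := h.2; simp only; linarith⟩
  obtain ⟨c, hc, d, hd, hcd⟩ := hrot.exists_positive_of_mem_Rpp
    ⟨ha.2, neg_nonneg.2 ha.1⟩ ⟨hb.2, neg_nonneg.2 hb.1⟩
  refine ⟨(d.2, -d.1), ⟨hd.2, neg_nonneg.2 hd.1⟩, (-c.2, c.1), ⟨neg_nonpos.2 hc.2, hc.1⟩, ?_, ?_⟩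
  · have hneg : ((d.2, -d.1) : ℝ × ℝ) = -(-d.2, d.1) := by simp
    rw [h.1, hneg, latticeOf_neg_left, latticeOf_comm (-d.2, d.1)]
    have hrotate (u v w : ℝ × ℝ) :
        w ∈ latticeOf (-u.2, u.1) (-v.2, v.1) ↔ (w.2, -w.1) ∈ latticeOf u v := by
      constructor <;> rintro ⟨m, n, hw⟩ <;> refine ⟨m, n, ?_⟩ <;>
        simp only [Prod.ext_iff, Prod.fst_add, Prod.snd_add, Prod.smul_fst, Prod.smul_snd,
          smul_eq_mul] at hw ⊢ <;> constructor <;> linarith [hw.1, hw.2]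
    ext w
    rw [hrotate c d, ← hcd.1, ← hrotate]
    simp
  · have := hcd.2
    simp only
    linarith

/-- A positive basis of a lattice all of whose nonzero horizontal vectors are longer than `2 * R`
can be transformed into a positive basis whose heights are less than `1 / (2 * R)`. -/
theorem exists_low {R : ℝ} (hR : 0 < R)
    (hadm : ∀ l ∈ L, l ≠ 0 → l.2 = 0 → 2 * R < |l.1|) (n : ℕ) :
    ∀ a b : ℝ × ℝ, IsOrientedBasis L a b → a ∈ Rpp → b ∈ Rmp →
      a.2 + b.2 ≤ n * (1 / (2 * R)) →
      ∃ c ∈ Rpp, ∃ d ∈ Rmp, IsOrientedBasis L c d ∧ c.2 < 1 / (2 * R) ∧ d.2 < 1 / (2 * R) := by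
  induction n with
  | zero =>
    rintro a b - ⟨-, ha⟩ ⟨-, hb⟩ h
    simp only [Nat.cast_zero, zero_mul] at h
    linarith
  | succ n ih =>
    rintro a b h ⟨ha1, ha2⟩ ⟨hb1, hb2⟩ hn
    push_cast at hn
    have hdet := h.2
    rcases lt_or_ge b.2 (1 / (2 * R)) with hb | hb
    · have hk : (0 : ℝ) ≤ ⌊a.2 / b.2⌋ := by exact_mod_cast Int.floor_nonneg.2 (by positivity)
      have hlow := (le_div_iff₀ hb2).1 (Int.floor_le (a.2 / b.2))
      have hupp := (div_lt_iff₀ hb2).1 (Int.lt_floor_add_one (a.2 / b.2))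
      refine ⟨_, ⟨?_, ?_⟩, b, ⟨hb1, hb2⟩, h.sub_left ⌊a.2 / b.2⌋, ?_, hb⟩ <;>
        simp only [Prod.fst_sub, Prod.snd_sub, Prod.smul_fst, Prod.smul_snd, smul_eq_mul] <;>
        nlinarith [mul_nonpos_of_nonneg_of_nonpos hk hb1]
    have ha0 : 0 < a.2 := by
      refine ha2.lt_of_ne' fun h0 ↦ ?_
      have hx := hadm a h.left_mem (fun h' ↦ by simp [h'] at ha1) h0
      rw [abs_of_pos ha1] at hx
      rw [div_le_iff₀ (by positivity)] at hb
      rw [h0] at hdet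
      nlinarith [mul_lt_mul_of_pos_left hx hb2]
    rcases lt_or_ge a.2 (1 / (2 * R)) with ha | ha
    · have hk : (0 : ℝ) ≤ (⌈b.2 / a.2⌉ - 1 : ℤ) := by
        have : 0 < ⌈b.2 / a.2⌉ := Int.ceil_pos.2 (by positivity)
        exact_mod_cast (by lia : 0 ≤ ⌈b.2 / a.2⌉ - 1)
      have hupp := (div_le_iff₀ ha0).1 (Int.le_ceil (b.2 / a.2))
      have hlow := (lt_div_iff₀ ha0).1 (sub_lt_iff_lt_add.2 (Int.ceil_lt_add_one (b.2 / a.2)))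
      have hx := mul_nonneg hk ha1.le
      refine ⟨a, ⟨ha1, ha2⟩, _, ⟨?_, ?_⟩, h.sub_right (⌈b.2 / a.2⌉ - 1), ha, ?_⟩ <;>
        simp only [Prod.fst_sub, Prod.snd_sub, Prod.smul_fst, Prod.smul_snd, smul_eq_mul] <;>
        push_cast at hx ⊢ <;> linarith
    have hr := h.sub_right 1
    have hl := h.sub_left 1
    simp only [Int.cast_one, one_smul] at hr hl
    rcases lt_or_ge a.2 b.2 with hab | hab
    · refine ih _ _ hr ⟨ha1, ha2⟩ ⟨?_, ?_⟩ ?_ <;>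
        simp only [Prod.fst_sub, Prod.snd_sub] <;> linarith
    · refine ih _ _ hl ⟨?_, ?_⟩ ⟨hb1, hb2⟩ ?_ <;>
        simp only [Prod.fst_sub, Prod.snd_sub] <;> linarith

/-- If both heights of a basis are less than `1 / (2 * R)`, the open centered parallelogram
contains the horizontal slit of half-length `R`. -/
theorem slit_subset_interiorP {R : ℝ} (h : IsOrientedBasis L a b) (hR : 0 < R)
    (ha : 0 ≤ a.2) (hb : 0 ≤ b.2) (ha' : a.2 < 1 / (2 * R)) (hb' : b.2 < 1 / (2 * R)) :
    Set.Icc (-R) R ×ˢ ({0} : Set ℝ) ⊆ interiorP a b := by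
  rintro ⟨r, y⟩ ⟨⟨hr1, hr2⟩, hy⟩
  obtain rfl : y = 0 := hy
  simp only at hr1 hr2
  have hdet := h.2
  rw [lt_div_iff₀ (by positivity)] at ha' hb'
  refine ⟨r * b.2, -(r * a.2), ⟨?_, ?_⟩, ⟨?_, ?_⟩, ?_⟩
  · nlinarith
  · nlinarith
  · nlinarith
  · nlinarith
  · ext
    · simp only [Prod.fst_add, Prod.smul_fst, smul_eq_mul]
      linear_combination -r * hdet
    · simp only [Prod.snd_add, Prod.smul_snd, smul_eq_mul]
      ring

end IsOrientedBasis

theorem mem_upper_or_neg_mem_upper {v : ℝ × ℝ} (hv : v ≠ 0) :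
    v ∈ Rpp ∪ Rmp ∨ -v ∈ Rpp ∪ Rmp := by
  simp only [Rpp, Rmp, Set.mem_union, Set.mem_ofPred_eq, Prod.fst_neg, Prod.snd_neg]
  rw [Ne, Prod.ext_iff] at hv
  simp only [Prod.fst_zero, Prod.snd_zero] at hv
  grind

theorem exists_upper_basis {a b : ℝ × ℝ} (hdet : |a.1 * b.2 - a.2 * b.1| = 1) :
    ∃ c ∈ Rpp ∪ Rmp, ∃ d ∈ Rpp ∪ Rmp, IsOrientedBasis (latticeOf a b) c d := by
  have ha : a ≠ 0 := by rintro rfl; simp at hdet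
  have hb : b ≠ 0 := by rintro rfl; simp at hdet
  wlog hau : a ∈ Rpp ∪ Rmp generalizing a
  · rw [← latticeOf_neg_left]
    refine this ?_ (neg_ne_zero.2 ha) ((mem_upper_or_neg_mem_upper ha).resolve_left hau)
    rw [← hdet, ← abs_neg]
    congr 1
    simp only [Prod.fst_neg, Prod.snd_neg]
    ring
  wlog hbu : b ∈ Rpp ∪ Rmp generalizing b
  · rw [latticeOf_comm, ← latticeOf_neg_left, latticeOf_comm]
    refine this (neg_ne_zero.2 hb) ?_ ((mem_upper_or_neg_mem_upper hb).resolve_left hbu)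
    rw [← hdet, ← abs_neg]
    congr 1
    simp only [Prod.fst_neg, Prod.snd_neg]
    ring
  rcases eq_or_eq_neg_of_abs_eq hdet with h | h
  · exact ⟨a, hau, b, hbu, rfl, h⟩
  · exact ⟨b, hbu, a, hau, latticeOf_comm a b, by linarith⟩

theorem exists_positive_basis {a b : ℝ × ℝ} (hdet : |a.1 * b.2 - a.2 * b.1| = 1) :
    ∃ c ∈ Rpp, ∃ d ∈ Rmp, IsOrientedBasis (latticeOf a b) c d := by
  obtain ⟨c, hc, d, hd, h⟩ := exists_upper_basis hdet
  rcases hc with hc | hc <;> rcases hd with hd | hd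
  · exact h.exists_positive_of_mem_Rpp hc hd
  · exact ⟨c, hc, d, hd, h⟩
  · have := h.2
    nlinarith [mul_nonneg (neg_nonneg.2 hc.1) hd.2, mul_pos hc.2 hd.1]
  · exact h.exists_positive_of_mem_Rmp hc hd

/-- Every unimodular lattice whose horizontal slits of length 2R are pairwise
disjoint admits a positive basis whose centered parallelogram contains the
slit [-R, R] × {0} in its interior. -/
theorem stmt_0 (R : ℝ) (hR : 0 < R) (Λ : Set (ℝ × ℝ)) (a b : ℝ × ℝ)
    (hdet : |a.1 * b.2 - a.2 * b.1| = 1)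
    (hΛ : Λ = latticeOf a b)
    (hadm : ∀ l ∈ Λ, l ≠ 0 → l.2 = 0 → 2 * R < |l.1|) :
    ∃ gp gm : ℝ × ℝ, gp ∈ Rpp ∧ gm ∈ Rmp ∧ Λ = latticeOf gp gm ∧
      (Set.Icc (-R) R ×ˢ ({0} : Set ℝ)) ⊆ interiorP gp gm := by
  subst hΛ
  obtain ⟨c, hc, d, hd, h⟩ := exists_positive_basis hdet
  obtain ⟨n, hn⟩ := exists_nat_ge ((c.2 + d.2) / (1 / (2 * R)))
  rw [div_le_iff₀ (by positivity)] at hn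
  obtain ⟨gp, hgp, gm, hgm, hg, hp, hm⟩ :=
    IsOrientedBasis.exists_low hR hadm n c d h hc hd hn
  exact ⟨gp, gm, hgp, hgm, hg.1, hg.slit_subset_interiorP hR hgp.2 hgm.2.le hp hm⟩
end

section
/- Let γ⁺ ∈ ℝ₊₊ and γ⁻ ∈ ℝ₋₊ be vectors with determinant det(γ⁺, γ⁻) = γ₁⁺γ₂⁻ − γ₂⁺γ₁⁻ = 1. Then the intersection of the interior of the centered parallelogram P(γ⁺, γ⁻) with the horizontal axis ℝ × {0} equals the open symmetric interval (−1/(2m), 1/(2m)) × {0}, where m = max(γ₂⁺, γ₂⁻). -/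
/-- A point `(x, 0)` lies in the open parallelogram spanned by a basis of determinant one iff its
coordinates `x * b.2` and `-x * a.2` in that basis have absolute value less than `1 / 2`. -/
theorem mk_zero_mem_interiorP_iff {a b : ℝ × ℝ} (hdet : a.1 * b.2 - a.2 * b.1 = 1) (x : ℝ) :
    (x, (0 : ℝ)) ∈ interiorP a b ↔ |x| * |a.2| < 1 / 2 ∧ |x| * |b.2| < 1 / 2 := by
  simp only [← abs_mul, abs_lt]
  constructor
  · rintro ⟨s, t, hs, ht, h⟩
    simp only [Prod.ext_iff, Prod.fst_add, Prod.snd_add, Prod.smul_fst, Prod.smul_snd,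
      smul_eq_mul] at h
    obtain ⟨h₁, h₂⟩ := h
    have hxb : x * b.2 = s := by linear_combination b.2 * h₁ - b.1 * h₂ + s * hdet
    have hxa : x * a.2 = -t := by linear_combination a.2 * h₁ - a.1 * h₂ - t * hdet
    rw [hxa, hxb]
    exact ⟨⟨neg_lt_neg ht.2, neg_lt.mp ht.1⟩, hs⟩
  · rintro ⟨ha, hb⟩
    refine ⟨x * b.2, -(x * a.2), hb, ⟨neg_lt_neg ha.2, neg_lt.mp ha.1⟩, ?_⟩
    ext
    · simp only [Prod.fst_add, Prod.smul_fst, smul_eq_mul]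
      linear_combination -x * hdet
    · simp only [Prod.snd_add, Prod.smul_snd, smul_eq_mul]
      ring

/-- For a positive pair (a, b) with determinant 1, the intersection of the open
parallelogram with the horizontal axis equals (−1/(2m), 1/(2m)) × {0}, where
m = max(a₂, b₂). -/
theorem stmt_2 (a b : ℝ × ℝ) (ha : a ∈ Rpp) (hb : b ∈ Rmp)
    (hdet : a.1 * b.2 - a.2 * b.1 = 1) :
    interiorP a b ∩ ((Set.univ : Set ℝ) ×ˢ ({0} : Set ℝ)) =
      Set.Ioo (-(1 / (2 * max a.2 b.2))) (1 / (2 * max a.2 b.2)) ×ˢ ({0} : Set ℝ) := by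
  have hm : 0 < max a.2 b.2 := lt_max_of_lt_right hb.2
  ext ⟨x, y⟩
  simp only [Set.mem_inter_iff, Set.mem_prod, Set.mem_univ, true_and, Set.mem_singleton_iff]
  refine and_congr_left fun hy => ?_
  subst hy
  rw [mk_zero_mem_interiorP_iff hdet, abs_of_nonneg ha.2, abs_of_pos hb.2, ← max_lt_iff,
    ← mul_max_of_nonneg _ _ (abs_nonneg x), ← lt_div_iff₀ hm, div_div, abs_lt, Set.mem_Ioo]
end

section
/- Let R > 0, let γ⁺ ∈ ℝ₊₊ and γ⁻ ∈ ℝ₋₊ be vectors with determinant det(γ⁺, γ⁻) = γ₁⁺γ₂⁻ − γ₂⁺γ₁⁻ = 1, and suppose that the second coordinates satisfy γ₂⁺ < 1/(2R) and γ₂⁻ < 1/(2R). Then the closed segment [−R, R] × {0} is contained in the interior of the centered parallelogram P(γ⁺, γ⁻). -/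
/-- If (a, b) is a positive pair with determinant 1 whose second coordinates
are both < 1/(2R), then the slit [−R, R] × {0} is contained in the interior of
the centered parallelogram P(a, b). -/
theorem stmt_3 (R : ℝ) (hR : 0 < R) (a b : ℝ × ℝ) (ha : a ∈ Rpp) (hb : b ∈ Rmp)
    (hdet : a.1 * b.2 - a.2 * b.1 = 1)
    (ha2 : a.2 < 1 / (2 * R)) (hb2 : b.2 < 1 / (2 * R)) :
    (Set.Icc (-R) R ×ˢ ({0} : Set ℝ)) ⊆ interiorP a b := by
  obtain ⟨-, ha0⟩ := ha
  obtain ⟨-, hb0⟩ := hb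
  rw [lt_div_iff₀ (by positivity)] at ha2 hb2
  rintro ⟨x, y⟩ ⟨⟨hx₁, hx₂⟩, hy⟩
  obtain rfl : y = 0 := hy
  dsimp only at hx₁ hx₂
  refine ⟨x * b.2, -(x * a.2), ⟨?_, ?_⟩, ⟨?_, ?_⟩, Prod.ext ?_ ?_⟩
  · nlinarith
  · nlinarith
  · nlinarith
  · nlinarith
  · simp only [Prod.fst_add, Prod.smul_fst, smul_eq_mul]
    linear_combination -x * hdet
  · simp only [Prod.snd_add, Prod.smul_snd, smul_eq_mul]
    ring
end

section
/- Let (a, b) be a positive basis of a lattice Λ ⊂ ℝ², i.e. a ∈ ℝ₊₊, b ∈ ℝ₋₊ and Λ = ℤa + ℤb. Then exactly one of the two conditions a − b ∈ ℝ₊₊ or b − a ∈ ℝ₋₊ holds; in the first case (a − b, b) is again a positive basis of Λ, in the second case (a, b − a) is again a positive basis of Λ, and in either case the new pair has the same determinant as (a, b). -/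
/-- The determinant of a pair of vectors in ℝ². -/
def det2 (u v : ℝ × ℝ) : ℝ := u.1 * v.2 - u.2 * v.1

theorem latticeOf_sub_left (a b : ℝ × ℝ) : latticeOf (a - b) b = latticeOf a b := by
  ext v
  constructor
  · rintro ⟨m, n, rfl⟩
    refine ⟨m, n - m, ?_⟩
    push_cast
    module
  · rintro ⟨m, n, rfl⟩
    refine ⟨m, n + m, ?_⟩
    push_cast
    module

theorem latticeOf_sub_right (a b : ℝ × ℝ) : latticeOf a (b - a) = latticeOf a b := by
  ext v
  constructor
  · rintro ⟨m, n, rfl⟩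
    refine ⟨m - n, n, ?_⟩
    push_cast
    module
  · rintro ⟨m, n, rfl⟩
    refine ⟨m + n, n, ?_⟩
    push_cast
    module

theorem det2_sub_left (a b : ℝ × ℝ) : det2 (a - b) b = det2 a b := by
  simp only [det2, Prod.fst_sub, Prod.snd_sub]
  ring

theorem det2_sub_right (a b : ℝ × ℝ) : det2 a (b - a) = det2 a b := by
  simp only [det2, Prod.fst_sub, Prod.snd_sub]
  ring

theorem sub_mem_Rpp_iff {a b : ℝ × ℝ} (ha : a ∈ Rpp) (hb : b ∈ Rmp) :
    a - b ∈ Rpp ↔ b.2 ≤ a.2 := by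
  have hx : 0 < a.1 - b.1 := sub_pos.2 (hb.1.trans_lt ha.1)
  simp [Rpp, -sub_pos, hx]

theorem sub_mem_Rmp_iff {a b : ℝ × ℝ} (ha : a ∈ Rpp) (hb : b ∈ Rmp) :
    b - a ∈ Rmp ↔ a.2 < b.2 := by
  have hx : b.1 ≤ a.1 := hb.1.trans ha.1.le
  simp [Rmp, hx]

/-- One Euclidean-type step: for a positive basis (a, b) of Λ exactly one of
a − b ∈ ℝ₊₊ or b − a ∈ ℝ₋₊ holds; in the first case (a − b, b) and in the
second case (a, b − a) is again a positive basis of Λ with the same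
determinant. -/
theorem stmt_4 (Λ : Set (ℝ × ℝ)) (a b : ℝ × ℝ) (ha : a ∈ Rpp) (hb : b ∈ Rmp)
    (hΛ : Λ = latticeOf a b) :
    Xor' (a - b ∈ Rpp) (b - a ∈ Rmp) ∧
    (a - b ∈ Rpp → a - b ∈ Rpp ∧ b ∈ Rmp ∧ Λ = latticeOf (a - b) b ∧
      det2 (a - b) b = det2 a b) ∧
    (b - a ∈ Rmp → a ∈ Rpp ∧ b - a ∈ Rmp ∧ Λ = latticeOf a (b - a) ∧
      det2 a (b - a) = det2 a b) := by
  refine ⟨?_, fun h => ⟨h, hb, ?_, det2_sub_left a b⟩, fun h => ⟨ha, h, ?_, det2_sub_right a b⟩⟩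
  · rw [sub_mem_Rpp_iff ha hb, sub_mem_Rmp_iff ha hb, ← not_le]
    exact xor_not_right.2 Iff.rfl
  · rw [hΛ, latticeOf_sub_left]
  · rw [hΛ, latticeOf_sub_right]
end

section
/- Let a⁰ ∈ ℝ₊₊ and b⁰ ∈ ℝ₋₊, and define sequences (aⁿ)ₙ≥₀, (bⁿ)ₙ≥₀ in ℝ² inductively by: aⁿ⁺¹ = aⁿ − bⁿ and bⁿ⁺¹ = bⁿ if aⁿ − bⁿ ∈ ℝ₊₊, while aⁿ⁺¹ = aⁿ and bⁿ⁺¹ = bⁿ − aⁿ if bⁿ − aⁿ ∈ ℝ₋₊. If the second coordinate aⁿ₂ is strictly positive for every n ≥ 0, then both sequences of second coordinates converge to zero: aⁿ₂ → 0 and bⁿ₂ → 0 as n → ∞. -/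
open Filter

/-- If a positive sequence `u` tends to zero and is stationary whenever it lies below `v`,
then a nonnegative limit of `v` is zero. -/
theorem limit_eq_zero_of_stationary_below {u v : ℕ → ℝ} {V : ℝ} (hu : ∀ n, 0 < u n)
    (hu0 : Tendsto u atTop (nhds 0)) (hv : Tendsto v atTop (nhds V)) (hV : 0 ≤ V)
    (hstat : ∀ n, u n < v n → u (n + 1) = u n) : V = 0 := by
  by_contra hne
  have hlt : 0 < V := lt_of_le_of_ne hV (Ne.symm hne)
  obtain ⟨N, hN⟩ := eventually_atTop.1 (hu0.eventually_lt hv hlt)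
  have hconst : ∀ n ≥ N, u n = u N := fun n hn => by
    induction n, hn using Nat.le_induction with
    | base => rfl
    | succ n hn ih => rw [hstat n (hN n hn), ih]
  have hlim : Tendsto u atTop (nhds (u N)) :=
    tendsto_const_nhds.congr' (eventually_atTop.2 ⟨N, fun n hn => (hconst n hn).symm⟩)
  exact (hu N).ne' (tendsto_nhds_unique hlim hu0)

/-- The subtractive Euclidean algorithm on positive reals, as long as it never stops,
drives both entries to zero. -/
theorem tendsto_zero_of_subtractive_euclid {q s : ℕ → ℝ} (hq : ∀ n, 0 < q n)
    (hs : ∀ n, 0 < s n)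
    (hrec : ∀ n, (s n ≤ q n ∧ q (n + 1) = q n - s n ∧ s (n + 1) = s n) ∨
      (q n < s n ∧ q (n + 1) = q n ∧ s (n + 1) = s n - q n)) :
    Tendsto q atTop (nhds 0) ∧ Tendsto s atTop (nhds 0) := by
  have conv : ∀ f : ℕ → ℝ, (∀ n, 0 < f n) → Antitone f →
      ∃ L, 0 ≤ L ∧ Tendsto f atTop (nhds L) := fun f hf hanti => by
    have hlim := tendsto_atTop_ciInf hanti ⟨0, by rintro _ ⟨n, rfl⟩; exact (hf n).le⟩
    exact ⟨_, ge_of_tendsto' hlim fun n => (hf n).le, hlim⟩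
  obtain ⟨Q, hQ0, hQ⟩ := conv q hq <| antitone_nat_of_succ_le fun n => by
    rcases hrec n with h | h <;> linarith [hs n]
  obtain ⟨S, hS0, hS⟩ := conv s hs <| antitone_nat_of_succ_le fun n => by
    rcases hrec n with h | h <;> linarith [hq n]
  have hdec : ∀ n, q n + s n - (q (n + 1) + s (n + 1)) = min (q n) (s n) := fun n => by
    rcases hrec n with ⟨h, h1, h2⟩ | ⟨h, h1, h2⟩
    · rw [min_eq_right h, h1, h2]; ring
    · rw [min_eq_left h.le, h1, h2]; ring
  have hmin : min Q S = 0 := by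
    have hsum := hQ.add hS
    have hdiff := hsum.sub (hsum.comp (tendsto_add_atTop_nat 1))
    rw [sub_self] at hdiff
    exact tendsto_nhds_unique (hQ.min hS) (hdiff.congr hdec)
  have hzero : Q = 0 ∧ S = 0 := by
    rcases min_choice Q S with h | h
    · obtain rfl : Q = 0 := h.symm.trans hmin
      refine ⟨rfl, limit_eq_zero_of_stationary_below hq hQ hS hS0 fun n hn => ?_⟩
      rcases hrec n with h | h
      · linarith
      · exact h.2.1
    · obtain rfl : S = 0 := h.symm.trans hmin
      refine ⟨limit_eq_zero_of_stationary_below hs hS hQ hQ0 fun n hn => ?_, rfl⟩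
      rcases hrec n with h | h
      · exact h.2.2
      · linarith
  rw [hzero.1] at hQ
  rw [hzero.2] at hS
  exact ⟨hQ, hS⟩

/-- For the Euclidean-type algorithm (aⁿ⁺¹, bⁿ⁺¹) = (aⁿ − bⁿ, bⁿ) if
aⁿ − bⁿ ∈ ℝ₊₊, and (aⁿ⁺¹, bⁿ⁺¹) = (aⁿ, bⁿ − aⁿ) if bⁿ − aⁿ ∈ ℝ₋₊, started at
a⁰ ∈ ℝ₊₊, b⁰ ∈ ℝ₋₊: if the second coordinate of aⁿ is strictly positive for
every n, then the second coordinates of aⁿ and bⁿ both tend to zero. -/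
theorem stmt_5 (a b : ℕ → ℝ × ℝ) (ha0 : a 0 ∈ Rpp) (hb0 : b 0 ∈ Rmp)
    (hrec : ∀ n : ℕ,
      (a n - b n ∈ Rpp ∧ a (n + 1) = a n - b n ∧ b (n + 1) = b n) ∨
      (b n - a n ∈ Rmp ∧ a (n + 1) = a n ∧ b (n + 1) = b n - a n))
    (hpos : ∀ n : ℕ, 0 < (a n).2) :
    Tendsto (fun n => (a n).2) atTop (nhds 0) ∧
      Tendsto (fun n => (b n).2) atTop (nhds 0) := by
  have hb : ∀ n, 0 < (b n).2 := fun n => by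
    induction n with
    | zero => exact hb0.2
    | succ n ih =>
      rcases hrec n with ⟨-, -, h⟩ | ⟨h, -, h'⟩
      · rwa [h]
      · rw [h']; exact h.2
  refine tendsto_zero_of_subtractive_euclid hpos hb fun n => ?_
  rcases hrec n with ⟨h, h1, h2⟩ | ⟨h, h1, h2⟩
  · exact Or.inl ⟨sub_nonneg.1 h.2, by rw [h1, Prod.snd_sub], by rw [h2]⟩
  · exact Or.inr ⟨sub_pos.1 h.2, by rw [h1], by rw [h2, Prod.snd_sub]⟩
end
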